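/- arXiv:1507.04409 — 5 statements merged into one kernel-verified Lean document; each statement's English description precedes it below -/
import Mathlib

section
/- Let d ≥ 1 and let Ω ⊆ ℝ^d be a set. Let (B_i)_{i∈I} be a family of closed balls B_i = \overline{B}(x_i, r_i) with centers x_i ∈ ∂Ω and radii 0 < r_i ≤ 1, having bounded overlap: there is N ∈ ℕ such that every point of ℝ^d belongs to at most N of the balls B_i. Then the set closure(⋃_{i∈I} B_i) \ ⋃_{i∈I} B_i is contained in ∂Ω. -/
open Metric

/-- If `(B i)` is a family of closed balls centered on the boundary of `Ω ⊆ ℝ^d`,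
with radii in `(0,1]` and bounded overlap, then
`closure (⋃ i, B i) \ ⋃ i, B i ⊆ ∂Ω`. -/
theorem stmt_0 {d : ℕ} (hd : 1 ≤ d) (Ω : Set (EuclideanSpace ℝ (Fin d)))
    {I : Type*} (c : I → EuclideanSpace ℝ (Fin d)) (r : I → ℝ)
    (hc : ∀ i, c i ∈ frontier Ω) (hr0 : ∀ i, 0 < r i) (hr1 : ∀ i, r i ≤ 1)
    (N : ℕ)
    (hN : ∀ y : EuclideanSpace ℝ (Fin d),
      {i : I | y ∈ closedBall (c i) (r i)}.encard ≤ (N : ℕ∞)) :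
    closure (⋃ i, closedBall (c i) (r i)) \ (⋃ i, closedBall (c i) (r i))
      ⊆ frontier Ω := by
  rintro y ⟨hy, hyU⟩
  by_contra hyF
  obtain ⟨δ, hδ, hsub⟩ := Metric.isOpen_iff.1 isClosed_frontier.isOpen_compl y hyF
  have hfar : ∀ i, δ ≤ dist (c i) y := fun i => by
    by_contra! h
    exact hsub (mem_ball.2 h) (hc i)
  -- Only finitely many of the balls come close to `y`, by compactness and bounded overlap.
  have hfin : {i | dist (c i) y ≤ 1 + δ ∧ δ / 2 ≤ r i}.Finite := by
    obtain ⟨t, ht, hcov⟩ := Metric.totallyBounded_iff.1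
      (isCompact_closedBall y (1 + δ)).totallyBounded (δ / 2) (half_pos hδ)
    refine (ht.biUnion fun z _ => Set.finite_of_encard_le_coe (hN z)).subset ?_
    rintro i ⟨hi, hri⟩
    obtain ⟨z, hz, hiz⟩ := Set.mem_iUnion₂.1 (hcov (mem_closedBall.2 hi))
    refine Set.mem_iUnion₂.2 ⟨z, hz, ?_⟩
    rw [mem_ball, dist_comm] at hiz
    exact mem_closedBall.2 (hiz.le.trans hri)
  have hclosed := hfin.isClosed_biUnion fun i _ => isClosed_closedBall (x := c i) (ε := r i)
  have hmem := hclosed.closure_subset_iff.2 subset_rfl (Metric.mem_closure_iff.2 fun ε hε => by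
    obtain ⟨w, hw, hyw⟩ := Metric.mem_closure_iff.1 hy (min ε (δ / 2)) (lt_min hε (half_pos hδ))
    obtain ⟨hyw₁, hyw₂⟩ := lt_min_iff.1 hyw
    obtain ⟨i, hi⟩ := Set.mem_iUnion.1 hw
    refine ⟨w, Set.mem_iUnion₂.2 ⟨i, ?_, hi⟩, hyw₁⟩
    rw [mem_closedBall, dist_comm] at hi
    rw [dist_comm] at hyw₂
    have htri := dist_triangle (c i) w y
    exact ⟨by linarith [hr1 i], by linarith [hfar i]⟩)
  obtain ⟨i, _, hi⟩ := Set.mem_iUnion₂.1 hmem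
  exact hyU (Set.mem_iUnion.2 ⟨i, hi⟩)
end

section
/- Let d ≥ 1 and let Ω ⊆ ℝ^d be an open set. Let (B_i)_{i∈I} be a family of closed balls B_i = \overline{B}(x_i, r_i) with centers x_i ∈ ∂Ω and radii 0 < r_i ≤ 1, having bounded overlap: there is N ∈ ℕ such that every point of ℝ^d belongs to at most N of the balls B_i. Then the set Ω̃ := Ω \ ⋃_{i∈I} B_i is open. -/
open Metric

/-- In a proper space, a family of closed balls covering each point finitely often has only
finitely many members with centers in a bounded set and radii bounded below. -/
theorem finite_setOf_center_mem_of_le_radius {X I : Type*} [PseudoMetricSpace X] [ProperSpace X]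
    {c : I → X} {r : I → ℝ} (hfin : ∀ y, {i | y ∈ closedBall (c i) (r i)}.Finite)
    {K : Set X} (hK : Bornology.IsBounded K) {ρ : ℝ} (hρ : 0 < ρ) :
    {i | c i ∈ K ∧ ρ ≤ r i}.Finite := by
  obtain ⟨t, ht, hcover⟩ := totallyBounded_iff.1
    (hK.isCompact_closure.totallyBounded.subset subset_closure) ρ hρ
  refine (ht.biUnion fun y _ => hfin y).subset ?_
  rintro i ⟨hiK, hi⟩
  obtain ⟨y, hy, hiy⟩ := Set.mem_iUnion₂.1 (hcover hiK)
  refine Set.mem_iUnion₂.2 ⟨y, hy, ?_⟩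
  rw [mem_ball'] at hiy
  exact mem_closedBall.2 (hiy.le.trans hi)

/-- If `Ω ⊆ ℝ^d` is open and `(B i)` is a family of closed balls centered on `∂Ω`,
with radii in `(0,1]` and bounded overlap, then `Ω \ ⋃ i, B i` is open. -/
theorem stmt_1 {d : ℕ} (hd : 1 ≤ d) (Ω : Set (EuclideanSpace ℝ (Fin d)))
    (hΩ : IsOpen Ω)
    {I : Type*} (c : I → EuclideanSpace ℝ (Fin d)) (r : I → ℝ)
    (hc : ∀ i, c i ∈ frontier Ω) (hr0 : ∀ i, 0 < r i) (hr1 : ∀ i, r i ≤ 1)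
    (N : ℕ)
    (hN : ∀ y : EuclideanSpace ℝ (Fin d),
      {i : I | y ∈ closedBall (c i) (r i)}.encard ≤ (N : ℕ∞)) :
    IsOpen (Ω \ ⋃ i, closedBall (c i) (r i)) := by
  rw [isOpen_iff_mem_nhds]
  rintro x ⟨hxΩ, hxB⟩
  obtain ⟨δ, hδ, hball⟩ := Metric.isOpen_iff.1 hΩ x hxΩ
  have hfin := finite_setOf_center_mem_of_le_radius
    (fun y => Set.finite_of_encard_le_coe (hN y))
    (isBounded_closedBall (x := x) (r := 1 + δ / 2)) (half_pos hδ)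
  have hclosed := hfin.isClosed_biUnion fun i _ => isClosed_closedBall (x := c i) (ε := r i)
  have hx : x ∉ ⋃ i ∈ {i | c i ∈ closedBall x (1 + δ / 2) ∧ δ / 2 ≤ r i},
      closedBall (c i) (r i) := fun h =>
    hxB (Set.iUnion₂_subset_iUnion _ _ h)
  filter_upwards [hΩ.mem_nhds hxΩ, ball_mem_nhds x (half_pos hδ),
    hclosed.isOpen_compl.mem_nhds hx] with y hyΩ hyx hy
  refine ⟨hyΩ, fun hyB => hy ?_⟩
  obtain ⟨i, hi⟩ := Set.mem_iUnion.1 hyB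
  have hci : δ ≤ dist (c i) x := by
    by_contra! h
    have := hc i
    rw [hΩ.frontier_eq] at this
    exact this.2 (hball h)
  have htri := dist_triangle (c i) y x
  rw [mem_ball] at hyx
  have hyi := mem_closedBall'.1 hi
  refine Set.mem_iUnion₂.2 ⟨i, ⟨mem_closedBall.2 ?_, ?_⟩, hi⟩
  · linarith [hr1 i]
  · linarith
end

section
/- Let d ≥ 1 and let Ω ⊆ ℝ^d be an open set. Let (B_i)_{i∈I} be a family of closed balls B_i = \overline{B}(x_i, r_i) with centers x_i ∈ ∂Ω and radii 0 < r_i ≤ 1, having bounded overlap: there is N ∈ ℕ such that every point of ℝ^d belongs to at most N of the balls B_i. Set Ω̃ := Ω \ ⋃_{i∈I} B_i. Then the topological boundary of Ω̃ satisfies ∂Ω̃ ⊆ (∂Ω \ ⋃_{i∈I} B_i) ∪ ⋃_{i∈I} S(x_i, r_i), where S(x_i, r_i) is the Euclidean sphere of center x_i and radius r_i. -/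
open Metric

/-- A family of closed balls with pointwise finite overlap contains only finitely many balls with
radius at least `δ > 0` and center in a given totally bounded set. -/
theorem finite_setOf_le_radius_of_totallyBounded {X I : Type*} [PseudoMetricSpace X]
    {c : I → X} {r : I → ℝ} (hfin : ∀ y, {i | y ∈ closedBall (c i) (r i)}.Finite)
    {K : Set X} (hK : TotallyBounded K) {δ : ℝ} (hδ : 0 < δ) :
    {i | δ ≤ r i ∧ c i ∈ K}.Finite := by
  obtain ⟨t, ht, hKt⟩ := Metric.totallyBounded_iff.1 hK δ hδ
  refine (ht.biUnion fun y _ => hfin y).subset ?_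
  rintro i ⟨hi, hiK⟩
  obtain ⟨y, hy, hiy⟩ := Set.mem_iUnion₂.1 (hKt hiK)
  refine Set.mem_iUnion₂.2 ⟨y, hy, ?_⟩
  rw [mem_ball, dist_comm] at hiy
  exact mem_closedBall.2 (hiy.le.trans hi)

/-- If `Ω ⊆ ℝ^d` is open and `(B i)` is a family of closed balls centered on `∂Ω`,
with radii in `(0,1]` and bounded overlap, then the boundary of `Ω̃ = Ω \ ⋃ i, B i`
satisfies `∂Ω̃ ⊆ (∂Ω \ ⋃ i, B i) ∪ ⋃ i, S(cᵢ, rᵢ)`. -/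
theorem stmt_2 {d : ℕ} (hd : 1 ≤ d) (Ω : Set (EuclideanSpace ℝ (Fin d)))
    (hΩ : IsOpen Ω)
    {I : Type*} (c : I → EuclideanSpace ℝ (Fin d)) (r : I → ℝ)
    (hc : ∀ i, c i ∈ frontier Ω) (hr0 : ∀ i, 0 < r i) (hr1 : ∀ i, r i ≤ 1)
    (N : ℕ)
    (hN : ∀ y : EuclideanSpace ℝ (Fin d),
      {i : I | y ∈ closedBall (c i) (r i)}.encard ≤ (N : ℕ∞)) :
    frontier (Ω \ ⋃ i, closedBall (c i) (r i)) ⊆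
      (frontier Ω \ ⋃ i, closedBall (c i) (r i)) ∪ ⋃ i, sphere (c i) (r i) := by
  have hfin : ∀ y, {i : I | y ∈ closedBall (c i) (r i)}.Finite := fun y =>
    Set.finite_of_encard_le_coe (hN y)
  intro p hp
  by_contra hcon
  rw [Set.mem_union, not_or, Set.mem_iUnion, not_exists] at hcon
  obtain ⟨hp_frontier, hp_sphere⟩ := hcon
  have hp_ball : ∀ i, p ∉ closedBall (c i) (r i) := by
    intro i hi
    have hlt : p ∈ ball (c i) (r i) :=
      mem_ball.2 (lt_of_le_of_ne (mem_closedBall.1 hi) (hp_sphere i))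
    obtain ⟨y, hy, hy'⟩ := mem_closure_iff.1 hp.1 _ isOpen_ball hlt
    exact hy'.2 (Set.mem_iUnion.2 ⟨i, ball_subset_closedBall hy⟩)
  have hpΩ : p ∈ Ω := by
    by_contra hpΩ
    refine hp_frontier ⟨⟨closure_mono Set.sdiff_subset hp.1, ?_⟩, ?_⟩
    · rwa [hΩ.interior_eq]
    · simpa using hp_ball
  obtain ⟨ε, hε, hεΩ⟩ := Metric.isOpen_iff.1 hΩ p hpΩ
  have hJ := finite_setOf_le_radius_of_totallyBounded hfin
    (isCompact_closedBall p 2).totallyBounded (half_pos hε)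
  have hclosed := hJ.isClosed_biUnion fun i _ => isClosed_closedBall (x := c i) (ε := r i)
  refine hp.2 (mem_interior.2 ⟨ball p (min (ε / 2) 1) ∩ _, ?_,
    isOpen_ball.inter hclosed.isOpen_compl, mem_ball_self (by positivity), ?_⟩)
  · rintro y ⟨hy, hyJ⟩
    rw [mem_ball, lt_min_iff] at hy
    refine ⟨hεΩ (mem_ball.2 (by linarith)), fun hyB => ?_⟩
    obtain ⟨i, hi⟩ := Set.mem_iUnion.1 hyB
    have hci : c i ∉ Ω := by
      have := (hc i).2
      rwa [hΩ.interior_eq] at this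
    have hle : ε ≤ dist (c i) p := not_lt.1 fun h => hci (hεΩ (mem_ball.2 h))
    have htri := dist_triangle_left (c i) p y
    have hyi := mem_closedBall.1 hi
    have hri := hr1 i
    exact hyJ (Set.mem_iUnion₂.2
      ⟨i, ⟨by linarith, mem_closedBall.2 (by linarith)⟩, hi⟩)
  · simpa using fun i _ _ => by simpa using hp_ball i
end

section
/- (Caccioppoli inequality for harmonic functions.) Let d ≥ 1, x₀ ∈ ℝ^d and r > 0. There is a constant C depending only on d such that: if u : ℝ^d → ℝ is twice continuously differentiable on an open set containing the closed ball \overline{B}(x₀, 3r) and harmonic there, i.e. Σ_{i=1}^d ∂²u/∂x_i²(y) = 0 for all y in that set, then for every α ∈ ℝ, ∫_{B(x₀,2r)} |∇u(y)|² dm(y) ≤ (C/r²) ∫_{B(x₀,3r)} |u(y) − α|² dm(y), where m is Lebesgue measure on ℝ^d. -/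
open Metric MeasureTheory

/-- A compactly supported `C¹` function has vanishing integral of each directional derivative. -/
lemma integral_fderiv_apply_eq_zero {E : Type*} [NormedAddCommGroup E] [NormedSpace ℝ E]
    [FiniteDimensional ℝ E] [MeasurableSpace E] [BorelSpace E] (μ : Measure E)
    [μ.IsAddHaarMeasure] {F : E → ℝ} (hF : ContDiff ℝ 1 F) (hc : HasCompactSupport F) (v : E) :
    Integrable (fun y => fderiv ℝ F y v) μ ∧ ∫ y, fderiv ℝ F y v ∂μ = 0 := by
  have hint : Integrable (fun y => fderiv ℝ F y v) μ :=
    ((hF.continuous_fderiv one_ne_zero).clm_apply continuous_const).integrable_of_hasCompactSupport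
      (hc.fderiv_apply ℝ v)
  refine ⟨hint, ?_⟩
  have h := integral_mul_fderiv_eq_neg_fderiv_mul_of_integrable (μ := μ) (v := v)
    (f := fun _ : E => (1 : ℝ)) (g := F) (by simp) (by simpa using hint)
    (by simpa using hF.continuous.integrable_of_hasCompactSupport hc)
    (by fun_prop) (fun x _ => hF.differentiable one_ne_zero x)
  simpa using h

/-- The squared norm of the gradient is the sum of the squared partial derivatives. -/
lemma norm_gradient_sq_eq_sum {d : ℕ} (u : EuclideanSpace ℝ (Fin d) → ℝ)
    (y : EuclideanSpace ℝ (Fin d)) :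
    ‖gradient u y‖ ^ 2 = ∑ i, (fderiv ℝ u y (EuclideanSpace.single i 1)) ^ 2 := by
  rw [EuclideanSpace.norm_sq_eq]
  refine Finset.sum_congr rfl fun i _ => ?_
  have h : inner ℝ (gradient u y) (EuclideanSpace.single i (1 : ℝ)) =
      fderiv ℝ u y (EuclideanSpace.single i 1) := by
    simp [gradient]
  rw [← h, EuclideanSpace.inner_single_right]
  simp

/-- Smooth cutoffs between concentric balls of radii `2r` and `5r/2`, with derivative `O(1/r)`
uniformly in the center and the radius. -/
lemma exists_cutoff (E : Type*) [NormedAddCommGroup E] [InnerProductSpace ℝ E]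
    [FiniteDimensional ℝ E] :
    ∃ K : ℝ, ∀ (x₀ : E) (r : ℝ), 0 < r → ∃ φ : E → ℝ, ContDiff ℝ 2 φ ∧
      (∀ y ∈ ball x₀ (2 * r), φ y = 1) ∧ tsupport φ ⊆ closedBall x₀ (5 / 2 * r) ∧
      ∀ y, ‖fderiv ℝ φ y‖ ≤ K / r := by
  let ψ : ContDiffBump (0 : E) := ⟨2, 5 / 2, by norm_num, by norm_num⟩
  have hψ : ContDiff ℝ 2 ψ := ψ.contDiff
  obtain ⟨K, hK⟩ := (hψ.continuous_fderiv two_ne_zero).bounded_above_of_compact_support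
    (ψ.hasCompactSupport.fderiv ℝ)
  refine ⟨K, fun x₀ r hr => ⟨fun y => ψ (r⁻¹ • (y - x₀)), ?_, ?_, ?_, ?_⟩⟩
  · exact hψ.comp (by fun_prop)
  · intro y hy
    apply ψ.one_of_mem_closedBall
    rw [mem_closedBall_zero_iff, norm_smul, norm_inv, Real.norm_of_nonneg hr.le,
      inv_mul_le_iff₀ hr]
    rw [mem_ball_iff_norm] at hy
    change _ ≤ r * 2
    linarith
  · refine closure_minimal (fun y hy => ?_) isClosed_closedBall
    have h : r⁻¹ • (y - x₀) ∈ Function.support ψ := hy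
    rw [ψ.support_eq, mem_ball_zero_iff, norm_smul, norm_inv, Real.norm_of_nonneg hr.le,
      inv_mul_lt_iff₀ hr] at h
    rw [mem_closedBall_iff_norm]
    change _ < r * (5 / 2) at h
    linarith
  · intro y
    have hg : HasFDerivAt (fun y : E => r⁻¹ • (y - x₀)) (r⁻¹ • ContinuousLinearMap.id ℝ E) y :=
      ((hasFDerivAt_id y).sub_const x₀).const_smul r⁻¹
    have h := ((hψ.differentiable two_ne_zero _).hasFDerivAt.comp y hg).fderiv
    change fderiv ℝ (fun y => ψ (r⁻¹ • (y - x₀))) y = _ at h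
    rw [h, ContinuousLinearMap.comp_smul, ContinuousLinearMap.comp_id, norm_smul, norm_inv,
      Real.norm_of_nonneg hr.le, div_eq_inv_mul]
    gcongr
    exact hK _

/-- Caccioppoli inequality for harmonic functions: there is `C = C(d)` such that if `u`
is `C²` and harmonic on an open set containing `closedBall x₀ (3r)`, then for any `α ∈ ℝ`,
`∫_{B(x₀,2r)} |∇u|² ≤ (C/r²) ∫_{B(x₀,3r)} |u − α|²`. -/
theorem stmt_6 {d : ℕ} (hd : 1 ≤ d) :
    ∃ C : ℝ, 0 < C ∧
      ∀ (x₀ : EuclideanSpace ℝ (Fin d)) (r : ℝ), 0 < r →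
        ∀ (u : EuclideanSpace ℝ (Fin d) → ℝ) (U : Set (EuclideanSpace ℝ (Fin d))),
          IsOpen U → closedBall x₀ (3 * r) ⊆ U → ContDiffOn ℝ 2 u U →
          (∀ y ∈ U, ∑ i : Fin d,
              fderiv ℝ (fun z => fderiv ℝ u z (EuclideanSpace.single i 1)) y
                (EuclideanSpace.single i 1) = 0) →
          ∀ α : ℝ,
            ∫ y in ball x₀ (2 * r), ‖gradient u y‖ ^ 2 ≤
              (C / r ^ 2) * ∫ y in ball x₀ (3 * r), |u y - α| ^ 2 := by
  obtain ⟨K, hK⟩ := exists_cutoff (EuclideanSpace ℝ (Fin d))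
  refine ⟨4 * d * K ^ 2 + 1, by positivity, fun x₀ r hr u U hU hBU hu hlap α => ?_⟩
  obtain ⟨φ, hφ, hφ1, hφs, hφK⟩ := hK x₀ r hr
  set e : Fin d → EuclideanSpace ℝ (Fin d) := fun i => EuclideanSpace.single i 1 with he
  let F : Fin d → EuclideanSpace ℝ (Fin d) → ℝ :=
    fun i y => φ y ^ 2 * ((u y - α) * fderiv ℝ u y (e i))
  have hu' : ContDiffOn ℝ 1 (fderiv ℝ u) U := hu.fderiv_of_isOpen hU (by norm_num)
  have hFφ (i) : tsupport (F i) ⊆ tsupport φ := by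
    refine closure_mono fun y hy h => hy ?_
    simp [F, h]
  have hball : closedBall x₀ (5 / 2 * r) ⊆ ball x₀ (3 * r) :=
    closedBall_subset_ball (by linarith)
  have hφU : tsupport φ ⊆ U := hφs.trans (hball.trans (ball_subset_closedBall.trans hBU))
  have hFc (i) : HasCompactSupport (F i) :=
    (isCompact_closedBall x₀ (5 / 2 * r)).of_isClosed_subset (isClosed_tsupport _)
      ((hFφ i).trans hφs)
  have hFd (i) : ContDiff ℝ 1 (F i) := by
    refine contDiff_iff_contDiffAt.2 fun y => ?_
    by_cases hy : y ∈ tsupport (F i)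
    swap
    · exact contDiffAt_const.congr_of_eventuallyEq (notMem_tsupport_iff_eventuallyEq.1 hy)
    have hUy : U ∈ nhds y := hU.mem_nhds (hφU (hFφ i hy))
    have h1 : ContDiffAt ℝ 1 u y := (hu.contDiffAt hUy).of_le (by norm_num)
    have h2 : ContDiffAt ℝ 1 (fderiv ℝ u) y := hu'.contDiffAt hUy
    have h3 : ContDiffAt ℝ 1 φ y := hφ.contDiffAt.of_le (by norm_num)
    exact (h3.pow 2).mul ((h1.sub contDiffAt_const).mul (h2.clm_apply contDiffAt_const))
  have hFder (i) {y} (hy : y ∈ U) : fderiv ℝ (F i) y (e i) =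
      φ y ^ 2 * fderiv ℝ u y (e i) ^ 2
        + 2 * φ y * (u y - α) * fderiv ℝ φ y (e i) * fderiv ℝ u y (e i)
        + φ y ^ 2 * (u y - α) * fderiv ℝ (fun z => fderiv ℝ u z (e i)) y (e i) := by
    have hUy : U ∈ nhds y := hU.mem_nhds hy
    have h1 : HasFDerivAt u (fderiv ℝ u y) y :=
      ((hu.contDiffAt hUy).differentiableAt two_ne_zero).hasFDerivAt
    have h2 : HasFDerivAt (fun z => fderiv ℝ u z (e i))
        (fderiv ℝ (fun z => fderiv ℝ u z (e i)) y) y :=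
      (((hu'.contDiffAt hUy).differentiableAt one_ne_zero).clm_apply
        (differentiableAt_const _)).hasFDerivAt
    have h3 : HasFDerivAt φ (fderiv ℝ φ y) y := (hφ.differentiable two_ne_zero y).hasFDerivAt
    have h := ((h3.pow 2).mul ((h1.sub_const α).mul h2)).fderiv
    change fderiv ℝ (F i) y = _ at h
    rw [h]
    simp
    ring
  have hpt (y) : (ball x₀ (2 * r)).indicator (fun y => ‖gradient u y‖ ^ 2) y ≤
      2 * ∑ i, fderiv ℝ (F i) y (e i) + (4 * d * K ^ 2 + 1) / r ^ 2 *
        (ball x₀ (3 * r)).indicator (fun y => |u y - α| ^ 2) y := by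
    by_cases hy : y ∈ ball x₀ (3 * r)
    · have hyU : y ∈ U := hBU (ball_subset_closedBall hy)
      have hφle : (ball x₀ (2 * r)).indicator (fun y => ‖gradient u y‖ ^ 2) y ≤
          φ y ^ 2 * ∑ i, fderiv ℝ u y (e i) ^ 2 := by
        by_cases hy2 : y ∈ ball x₀ (2 * r)
        · simp [hy2, hφ1 y hy2, norm_gradient_sq_eq_sum, he]
        · rw [Set.indicator_of_notMem hy2]
          positivity
      refine hφle.trans ?_
      have hq (i) : fderiv ℝ φ y (e i) ^ 2 ≤ K ^ 2 / r ^ 2 := by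
        have h := (fderiv ℝ φ y).le_opNorm (e i)
        have h1 : ‖e i‖ = 1 := by simp [he]
        rw [h1, mul_one] at h
        rw [← div_pow, ← sq_abs]
        exact pow_le_pow_left₀ (abs_nonneg _) (h.trans (hφK y)) 2
      have hi (i) : φ y ^ 2 * fderiv ℝ u y (e i) ^ 2 ≤ 2 * fderiv ℝ (F i) y (e i)
          - 2 * (φ y ^ 2 * (u y - α)) * fderiv ℝ (fun z => fderiv ℝ u z (e i)) y (e i)
          + 4 * (K ^ 2 / r ^ 2) * (u y - α) ^ 2 := by
        rw [hFder i hyU]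
        have := mul_le_mul_of_nonneg_right (hq i) (sq_nonneg (u y - α))
        nlinarith [sq_nonneg (φ y * fderiv ℝ u y (e i) + 2 * (u y - α) * fderiv ℝ φ y (e i))]
      have hs := Finset.sum_le_sum fun i (_ : i ∈ Finset.univ) => hi i
      rw [Finset.sum_add_distrib, Finset.sum_sub_distrib, ← Finset.mul_sum, ← Finset.mul_sum,
        ← Finset.mul_sum, hlap y hyU] at hs
      refine hs.trans ?_
      rw [Set.indicator_of_mem hy, sq_abs]
      have h0 : 0 ≤ (u y - α) ^ 2 / r ^ 2 := by positivity
      have h1 : (4 * d * K ^ 2 + 1) / r ^ 2 * (u y - α) ^ 2 =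
          d * (4 * (K ^ 2 / r ^ 2) * (u y - α) ^ 2) + (u y - α) ^ 2 / r ^ 2 := by ring
      simp only [Finset.sum_const, Finset.card_univ, Fintype.card_fin, nsmul_eq_mul]
      linarith
    · have h2 : y ∉ ball x₀ (2 * r) := fun h => hy (ball_subset_ball (by linarith) h)
      have h3 (i) : fderiv ℝ (F i) y = 0 := fderiv_of_notMem_tsupport (𝕜 := ℝ) fun h =>
        hy (hball (hφs (hFφ i h)))
      simp [h2, hy, h3]
  have hgc : ContinuousOn (fun y => ‖gradient u y‖ ^ 2) (closedBall x₀ (3 * r)) := by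
    have h : ContinuousOn (fun y => ‖fderiv ℝ u y‖ ^ 2) (closedBall x₀ (3 * r)) :=
      ((hu'.continuousOn.mono hBU).norm).pow 2
    simpa [gradient] using h
  have huc : ContinuousOn (fun y => |u y - α| ^ 2) (closedBall x₀ (3 * r)) :=
    (((hu.continuousOn.mono hBU).sub continuousOn_const).abs).pow 2
  have hgi : IntegrableOn (fun y => ‖gradient u y‖ ^ 2) (ball x₀ (2 * r)) :=
    (hgc.integrableOn_compact (isCompact_closedBall _ _)).mono_set
      ((ball_subset_ball (by linarith)).trans ball_subset_closedBall)
  have hui : IntegrableOn (fun y => |u y - α| ^ 2) (ball x₀ (3 * r)) :=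
    (huc.integrableOn_compact (isCompact_closedBall _ _)).mono_set ball_subset_closedBall
  have hdiv (i) := integral_fderiv_apply_eq_zero volume (hFd i) (hFc i) (e i)
  have hsi : Integrable (fun y => 2 * ∑ i, fderiv ℝ (F i) y (e i)) :=
    (integrable_finsetSum _ fun i _ => (hdiv i).1).const_mul 2
  have hvi := ((integrable_indicator_iff measurableSet_ball).2 hui).const_mul
    ((4 * d * K ^ 2 + 1) / r ^ 2)
  have hmain := integral_mono ((integrable_indicator_iff measurableSet_ball).2 hgi)
    (hsi.add hvi) hpt
  simp only [Pi.add_apply] at hmain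
  rw [integral_add hsi hvi, integral_const_mul, integral_const_mul,
    integral_finsetSum _ fun i _ => (hdiv i).1, integral_indicator measurableSet_ball,
    integral_indicator measurableSet_ball] at hmain
  simpa [fun i => (hdiv i).2] using hmain
end

section
/- There is an absolute constant C such that for every finite Borel measure ν on ℝ², every x ∈ ℝ² and every r > 0, one has ∬_{B(x,3r)×B(x,3r)} ( ∫_{B(x,5r)} |log(|z−ξ|/|y−ξ|)| dν(ξ) )² dm(y) dm(z) ≤ C ν(B(x,5r))² r⁴, where m is Lebesgue measure on ℝ². -/
open Metric MeasureTheory ENNReal Classical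

/-- In the plane, the integral of `1 / |z|` over the disc of radius `R` is `2 π R`. -/
lemma lintegral_ball_zero_ofReal_norm_inv {R : ℝ} (hR : 0 < R) :
    ∫⁻ z in ball (0 : EuclideanSpace ℝ (Fin 2)) R, ENNReal.ofReal ‖z‖⁻¹ =
      ENNReal.ofReal (2 * Real.pi * R) := by
  set f : ℝ → ℝ := (Set.Iio R).indicator fun t ↦ t⁻¹ with hf
  have hmul : Set.EqOn (fun y : ℝ ↦ y ^ (Module.finrank ℝ (EuclideanSpace ℝ (Fin 2)) - 1) • f y)
      ((Set.Iio R).indicator fun _ ↦ (1 : ℝ)) (Set.Ioi 0) := by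
    intro y (hy : 0 < y)
    by_cases hyR : y < R <;> simp [hf, hyR, hy.ne']
  have hball : (ball (0 : EuclideanSpace ℝ (Fin 2)) R).indicator (fun z ↦ ENNReal.ofReal ‖z‖⁻¹) =
      fun z ↦ ENNReal.ofReal (f ‖z‖) := by
    ext z
    by_cases hz : ‖z‖ < R <;> simp [hf, hz]
  have hset : (Set.Ioi (0 : ℝ)) ∩ Set.Iio R = Set.Ioo 0 R := rfl
  have hf_int : Integrable (fun z : EuclideanSpace ℝ (Fin 2) ↦ f ‖z‖) := by
    rw [integrable_fun_norm_addHaar, integrableOn_congr_fun hmul measurableSet_Ioi,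
      IntegrableOn, integrable_indicator_iff measurableSet_Iio, IntegrableOn,
      Measure.restrict_restrict measurableSet_Iio, Set.inter_comm, hset]
    simp
  have hnonneg : ∀ z : EuclideanSpace ℝ (Fin 2), 0 ≤ f ‖z‖ := fun z ↦
    Set.indicator_apply_nonneg fun _ ↦ by positivity
  rw [← lintegral_indicator measurableSet_ball, hball,
    ← ofReal_integral_eq_lintegral_ofReal hf_int (.of_forall hnonneg),
    integral_fun_norm_addHaar, setIntegral_congr_fun measurableSet_Ioi hmul,
    setIntegral_indicator measurableSet_Iio, hset]
  simp [Measure.real, Real.pi_nonneg, hR.le]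
  ring_nf

/-- In the plane, the integral of `1 / |z - ξ|` over the disc of center `ξ` and radius `R` is at
most `2 π R`. -/
lemma lintegral_ball_edist_inv_le (ξ : EuclideanSpace ℝ (Fin 2)) {R : ℝ} (hR : 0 < R) :
    ∫⁻ z in ball ξ R, (edist z ξ)⁻¹ ≤ ENNReal.ofReal (2 * Real.pi * R) := by
  rw [← lintegral_ball_zero_ofReal_norm_inv hR, ← lintegral_indicator measurableSet_ball,
    ← lintegral_indicator measurableSet_ball, ← lintegral_add_right_eq_self _ ξ]
  refine lintegral_mono_ae ?_
  filter_upwards [Measure.ae_ne volume (0 : EuclideanSpace ℝ (Fin 2))] with z hz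
  by_cases h : ‖z‖ < R
  · simp [Set.indicator, h, edist_dist, ENNReal.ofReal_inv_of_pos (norm_pos_iff.2 hz)]
  · simp [Set.indicator, h]

/-- Cauchy-Schwarz against the constant function `1`. -/
lemma sq_lintegral_le {α : Type*} [MeasurableSpace α] (μ : Measure α) {f : α → ℝ≥0∞}
    (hf : AEMeasurable f μ) : (∫⁻ a, f a ∂μ) ^ 2 ≤ μ Set.univ * ∫⁻ a, f a ^ 2 ∂μ := by
  have h := ENNReal.lintegral_mul_le_Lp_mul_Lq μ Real.HolderConjugate.two_two
    (aemeasurable_const (b := (1 : ℝ≥0∞))) hf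
  simp only [Pi.mul_apply, one_mul, ENNReal.one_rpow, lintegral_const] at h
  calc (∫⁻ a, f a ∂μ) ^ 2
      ≤ (μ Set.univ ^ (1 / 2 : ℝ) * (∫⁻ a, f a ^ (2 : ℝ) ∂μ) ^ (1 / 2 : ℝ)) ^ 2 := by gcongr
    _ = μ Set.univ * ∫⁻ a, f a ^ 2 ∂μ := by
      rw [mul_pow, ← ENNReal.rpow_natCast, ← ENNReal.rpow_natCast, ← ENNReal.rpow_mul,
        ← ENNReal.rpow_mul]
      norm_num

/-- For distances `a, b < R`, `|log (a / b)| ≤ 2 (R / a) ^ (1 / 2) + 2 (R / b) ^ (1 / 2)`. -/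
lemma abs_log_div_le {a b R : ℝ} (ha : 0 < a) (hb : 0 < b) (haR : a ≤ R) (hbR : b ≤ R) :
    |Real.log (a / b)| ≤ 2 * (R / a) ^ (1 / 2 : ℝ) + 2 * (R / b) ^ (1 / 2 : ℝ) := by
  have hR : 0 < R := ha.trans_le haR
  have key : ∀ t, 0 < t → t ≤ R →
      0 ≤ Real.log (R / t) ∧ Real.log (R / t) ≤ 2 * (R / t) ^ (1 / 2 : ℝ) := fun t ht htR ↦
    ⟨Real.log_nonneg ((one_le_div ht).2 htR),
      (Real.log_le_rpow_div (by positivity) one_half_pos).trans_eq (by ring)⟩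
  obtain ⟨ha0, ha1⟩ := key a ha haR
  obtain ⟨hb0, hb1⟩ := key b hb hbR
  have : Real.log (a / b) = Real.log (R / b) - Real.log (R / a) := by
    rw [Real.log_div ha.ne' hb.ne', Real.log_div hR.ne' hb.ne', Real.log_div hR.ne' ha.ne']
    ring
  rw [this, abs_le]
  constructor <;> linarith

lemma ofReal_abs_log_dist_div_dist_le {X : Type*} [MetricSpace X] [DecidableEq X] {z y ξ : X} {R : ℝ}
    (hR : 0 < R) (hz : dist z ξ ≤ R) (hy : dist y ξ ≤ R) :
    (if ξ = y ∨ ξ = z then (⊤ : ℝ≥0∞) else ENNReal.ofReal |Real.log (dist z ξ / dist y ξ)|) ≤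
      2 * (ENNReal.ofReal R * (edist z ξ)⁻¹) ^ (1 / 2 : ℝ) +
        2 * (ENNReal.ofReal R * (edist y ξ)⁻¹) ^ (1 / 2 : ℝ) := by
  have hR' : ENNReal.ofReal R ≠ 0 := by simpa using hR
  split_ifs with h
  · rcases h with rfl | rfl <;> simp [ENNReal.mul_top, hR']
  · push Not at h
    have hz0 : 0 < dist z ξ := dist_pos.2 h.2.symm
    have hy0 : 0 < dist y ξ := dist_pos.2 h.1.symm
    refine (ENNReal.ofReal_le_ofReal (abs_log_div_le hz0 hy0 hz hy)).trans_eq ?_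
    have key : ∀ t : ℝ, 0 < t → ENNReal.ofReal (2 * (R / t) ^ (1 / 2 : ℝ)) =
        2 * (ENNReal.ofReal R * (ENNReal.ofReal t)⁻¹) ^ (1 / 2 : ℝ) := fun t ht ↦ by
      rw [ENNReal.ofReal_mul (by norm_num), ← ENNReal.ofReal_rpow_of_pos (by positivity),
        ENNReal.ofReal_div_of_pos ht, div_eq_mul_inv]
      simp
    rw [ENNReal.ofReal_add (by positivity) (by positivity), key _ hz0, key _ hy0, edist_dist,
      edist_dist]

lemma two_mul_rpow_half_sq (a : ℝ≥0∞) : (2 * a ^ (1 / 2 : ℝ)) ^ 2 = 4 * a := by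
  rw [mul_pow, ← ENNReal.rpow_natCast (a ^ _), ← ENNReal.rpow_mul]
  norm_num

lemma ENNReal.add_sq_le_two_mul (a b : ℝ≥0∞) : (a + b) ^ 2 ≤ 2 * (a ^ 2 + b ^ 2) := by
  have h := ENNReal.rpow_add_le_mul_rpow_add_rpow a b (p := 2) one_le_two
  norm_num at h
  exact h

/-- There is an absolute constant `C` such that for every finite Borel measure `ν` on
`ℝ²`, every `x ∈ ℝ²` and every `r > 0`,
`∬_{B(x,3r)×B(x,3r)} ( ∫_{B(x,5r)} |log(|z−ξ|/|y−ξ|)| dν(ξ) )² dm(y) dm(z)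
  ≤ C ν(B(x,5r))² r⁴`,
where the inner integrand is interpreted as `+∞` when `ξ = y` or `ξ = z`. -/
theorem stmt_12 :
    ∃ C : ℝ, 0 < C ∧
      ∀ (ν : Measure (EuclideanSpace ℝ (Fin 2))), IsFiniteMeasure ν →
        ∀ (x : EuclideanSpace ℝ (Fin 2)) (r : ℝ), 0 < r →
          (∫⁻ z in ball x (3 * r), ∫⁻ y in ball x (3 * r),
              (∫⁻ ξ in ball x (5 * r),
                  (if ξ = y ∨ ξ = z then (⊤ : ℝ≥0∞)
                    else ENNReal.ofReal |Real.log (dist z ξ / dist y ξ)|) ∂ν) ^ 2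
              ∂volume ∂volume) ≤
            ENNReal.ofReal C * (ν (ball x (5 * r))) ^ 2 * ENNReal.ofReal (r ^ 4) := by
  refine ⟨18432 * Real.pi ^ 2, by positivity, fun ν _ x r hr ↦ ?_⟩
  have h8 : 0 < 8 * r := by positivity
  have hdist : ∀ z ∈ ball x (3 * r), ∀ ξ ∈ ball x (5 * r), dist z ξ < 8 * r := by
    intro z hz ξ hξ
    rw [mem_ball] at hz hξ
    linarith [dist_triangle_right z ξ x]
  set B := ball x (3 * r)
  set N := ν (ball x (5 * r))
  set K : EuclideanSpace ℝ (Fin 2) → EuclideanSpace ℝ (Fin 2) → ℝ≥0∞ := fun z ξ ↦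
    4 * (ENNReal.ofReal (8 * r) * (edist z ξ)⁻¹)
  have hKm : Measurable (Function.uncurry K) := by
    unfold Function.uncurry
    fun_prop
  have hKz : ∀ z, Measurable (K z) := fun z ↦ by fun_prop
  set G : EuclideanSpace ℝ (Fin 2) → ℝ≥0∞ := fun z ↦ ∫⁻ ξ in ball x (5 * r), K z ξ ∂ν with hG
  have hGm : Measurable G := hKm.lintegral_prod_right
  have hinner : ∀ z ∈ B, ∀ y ∈ B, (∫⁻ ξ in ball x (5 * r),
      (if ξ = y ∨ ξ = z then (⊤ : ℝ≥0∞)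
        else ENNReal.ofReal |Real.log (dist z ξ / dist y ξ)|) ∂ν) ^ 2 ≤
      2 * N * (G z + G y) := by
    intro z hz y hy
    set k : EuclideanSpace ℝ (Fin 2) → EuclideanSpace ℝ (Fin 2) → ℝ≥0∞ := fun z ξ ↦
      2 * (ENNReal.ofReal (8 * r) * (edist z ξ)⁻¹) ^ (1 / 2 : ℝ)
    calc _ ≤ (∫⁻ ξ in ball x (5 * r), (k z ξ + k y ξ) ∂ν) ^ 2 := by
          gcongr 1
          exact setLIntegral_mono' measurableSet_ball fun ξ hξ ↦
            ofReal_abs_log_dist_div_dist_le h8 (hdist z hz ξ hξ).le (hdist y hy ξ hξ).le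
      _ ≤ N * ∫⁻ ξ in ball x (5 * r), (k z ξ + k y ξ) ^ 2 ∂ν := by
          refine (sq_lintegral_le _ ?_).trans_eq ?_
          · fun_prop
          · rw [Measure.restrict_apply_univ]
      _ ≤ N * ∫⁻ ξ in ball x (5 * r), 2 * (K z ξ + K y ξ) ∂ν := by
          gcongr with ξ
          exact (ENNReal.add_sq_le_two_mul _ _).trans_eq (by simp only [k, K, two_mul_rpow_half_sq])
      _ = 2 * N * (G z + G y) := by
          rw [lintegral_const_mul _ (by fun_prop), lintegral_add_left (hKz z)]
          ring
  have hGint : ∫⁻ z in B, G z ≤ N * ENNReal.ofReal (512 * Real.pi * r ^ 2) := by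
    rw [hG, lintegral_lintegral_swap hKm.aemeasurable, mul_comm N, ← setLIntegral_const]
    refine setLIntegral_mono' measurableSet_ball fun ξ hξ ↦ ?_
    calc ∫⁻ z in B, K z ξ ≤ ∫⁻ z in ball ξ (8 * r), K z ξ :=
          lintegral_mono_set fun z hz ↦ hdist z hz ξ hξ
      _ = 4 * (ENNReal.ofReal (8 * r) * ∫⁻ z in ball ξ (8 * r), (edist z ξ)⁻¹) := by
          rw [lintegral_const_mul _ (by fun_prop), lintegral_const_mul _ (by fun_prop)]
      _ ≤ 4 * (ENNReal.ofReal (8 * r) * ENNReal.ofReal (2 * Real.pi * (8 * r))) := by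
          gcongr
          exact lintegral_ball_edist_inv_le ξ h8
      _ = ENNReal.ofReal (512 * Real.pi * r ^ 2) := by
          rw [← ENNReal.ofReal_mul h8.le, ← ENNReal.ofReal_ofNat 4,
            ← ENNReal.ofReal_mul (by norm_num)]
          ring_nf
  have hB : volume B = ENNReal.ofReal (9 * Real.pi * r ^ 2) := by
    rw [EuclideanSpace.volume_ball_fin_two, ← ENNReal.ofReal_pow (by positivity),
      ← ENNReal.ofReal_mul (by positivity)]
    ring_nf
  calc _ ≤ ∫⁻ z in B, ∫⁻ y in B, 2 * N * (G z + G y) :=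
        setLIntegral_mono' measurableSet_ball fun z hz ↦
          setLIntegral_mono' measurableSet_ball fun y hy ↦ hinner z hz y hy
    _ = 2 * N * (2 * (volume B * ∫⁻ z in B, G z)) := by
        have : ∀ z, ∫⁻ y in B, 2 * N * (G z + G y) =
            2 * N * (volume B * G z + ∫⁻ y in B, G y) := fun z ↦ by
          rw [lintegral_const_mul _ (by fun_prop), lintegral_add_left (by fun_prop),
            setLIntegral_const, mul_comm (G z)]
        simp_rw [this]
        rw [lintegral_const_mul _ (by fun_prop), lintegral_add_left (by fun_prop),
          lintegral_const_mul _ hGm, setLIntegral_const]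
        ring
    _ ≤ 2 * N * (2 * (ENNReal.ofReal (9 * Real.pi * r ^ 2) *
          (N * ENNReal.ofReal (512 * Real.pi * r ^ 2)))) := by
        rw [hB]
        gcongr
    _ = 4 * (ENNReal.ofReal (9 * Real.pi * r ^ 2) * ENNReal.ofReal (512 * Real.pi * r ^ 2)) *
          N ^ 2 := by ring
    _ = ENNReal.ofReal (18432 * Real.pi ^ 2) * N ^ 2 * ENNReal.ofReal (r ^ 4) := by
        rw [mul_right_comm (ENNReal.ofReal _) (N ^ 2), ← ENNReal.ofReal_mul (by positivity),
          ← ENNReal.ofReal_mul (by positivity), ← ENNReal.ofReal_ofNat 4,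
          ← ENNReal.ofReal_mul (by norm_num)]
        ring_nf
end
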